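/- arXiv:2103.05998 — 2 statements merged into one kernel-verified Lean document; each statement's English description precedes it below -/
import Mathlib

section
/- For every positive integer m and every finite collection of T vectors v_1, ..., v_T ∈ {−1,1}^m, there exists a vector x ∈ {−1,1}^m such that |⟨v_i, x⟩| ≤ 12√T for every i = 1, ..., T, where ⟨·,·⟩ denotes the standard inner product on R^m. -/
/-- A direction supported on `A`, orthogonal to the vectors of `S`, with small weighted
quadratic form. -/
lemma exists_direction {m : ℕ} {ι : Type} [Fintype ι] (A : Finset (Fin m))
    (S : Finset (Fin m → ℝ)) (hS : S.card < A.card) (u : ι → Fin m → ℝ)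
    (hu : ∀ i j, u i j ^ 2 = 1) (a : ι → ℝ) (ha : ∀ i, 0 ≤ a i) :
    ∃ y : Fin m → ℝ, (∀ j, j ∉ A → y j = 0) ∧ ∑ j, y j ^ 2 = 1 ∧
      (∀ w ∈ S, ∑ j, w j * y j = 0) ∧
      ((A.card : ℝ) - S.card) * ∑ i, a i * (∑ j, u i j * y j) ^ 2 ≤ A.card * ∑ i, a i := by
  classical
  let F : Finset (EuclideanSpace ℝ (Fin m)) := (S.image (fun w => (WithLp.toLp 2 w : EuclideanSpace ℝ (Fin m)))) ∪
    (Aᶜ.image (fun j => (EuclideanSpace.single j (1:ℝ) : EuclideanSpace ℝ (Fin m))))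
  let V : Submodule ℝ (EuclideanSpace ℝ (Fin m)) := Submodule.span ℝ (F : Set (EuclideanSpace ℝ (Fin m)))
  have hin : ∀ (p q : EuclideanSpace ℝ (Fin m)), inner ℝ p q = ∑ j, p j * q j := by
    intro p q
    simp [PiLp.inner_apply, mul_comm]
  have hVdim : Module.finrank ℝ V ≤ S.card + (m - A.card) := by
    refine (finrank_span_finset_le_card F).trans ((Finset.card_union_le _ _).trans ?_)
    refine Nat.add_le_add Finset.card_image_le (Finset.card_image_le.trans ?_)
    rw [Finset.card_compl, Fintype.card_fin]
  have hA : A.card ≤ m := by simpa using Finset.card_le_univ A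
  have hsum : Module.finrank ℝ V + Module.finrank ℝ Vᗮ = m := by
    rw [Submodule.finrank_add_finrank_orthogonal]; simp
  have hd : A.card ≤ Module.finrank ℝ Vᗮ + S.card := by omega
  set d := Module.finrank ℝ Vᗮ with hd_def
  let b := stdOrthonormalBasis ℝ Vᗮ
  have hb : Orthonormal ℝ (fun k => (b k : EuclideanSpace ℝ (Fin m))) :=
    b.orthonormal.comp_linearIsometry Vᗮ.subtypeₗᵢ
  have horth : ∀ k, ∀ f ∈ F, inner ℝ f (b k : EuclideanSpace ℝ (Fin m)) = 0 := by
    intro k f hf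
    exact Submodule.inner_right_of_mem_orthogonal (Submodule.subset_span hf) (b k).2
  have hsupp : ∀ k, ∀ j, j ∉ A → (b k : EuclideanSpace ℝ (Fin m)) j = 0 := by
    intro k j hj
    have := horth k (EuclideanSpace.single j (1:ℝ)) (by
      simp only [F, Finset.mem_union, Finset.mem_image, Finset.mem_compl]
      exact Or.inr ⟨j, hj, rfl⟩)
    simpa [EuclideanSpace.inner_single_left] using this
  have hbes : ∀ i, ∑ k, (∑ j, u i j * (b k : EuclideanSpace ℝ (Fin m)) j) ^ 2 ≤ A.card := by
    intro i
    let p : EuclideanSpace ℝ (Fin m) := WithLp.toLp 2 (fun j => if j ∈ A then u i j else 0)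
    have h1 := hb.sum_inner_products_le p (s := Finset.univ)
    have h2 : ‖p‖ ^ 2 = A.card := by
      rw [EuclideanSpace.norm_sq_eq]
      simp only [p, Real.norm_eq_abs, sq_abs, ite_pow, hu]
      simp
    rw [h2] at h1
    refine le_trans (le_of_eq ?_) h1
    refine Finset.sum_congr rfl fun k _ => ?_
    rw [hin, Real.norm_eq_abs, sq_abs]
    congr 1
    refine Finset.sum_congr rfl fun j _ => ?_
    by_cases hj : j ∈ A
    · simp [p, hj, mul_comm]
    · simp [p, hj, hsupp k j hj]
  have hex : ∃ k, (d : ℝ) * ∑ i, a i * (∑ j, u i j * (b k : EuclideanSpace ℝ (Fin m)) j) ^ 2 ≤ A.card * ∑ i, a i := by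
    by_contra! hcon
    have hdpos : 0 < d := by omega
    have : Nonempty (Fin d) := ⟨⟨0, hdpos⟩⟩
    have h1 : ∑ k : Fin d, ((A.card : ℝ) * ∑ i, a i) <
        ∑ k : Fin d, (d : ℝ) * ∑ i, a i * (∑ j, u i j * (b k : EuclideanSpace ℝ (Fin m)) j) ^ 2 :=
      Finset.sum_lt_sum_of_nonempty Finset.univ_nonempty fun k _ => hcon k
    rw [Finset.sum_const, Finset.card_univ,
      Fintype.card_fin, nsmul_eq_mul, ← Finset.mul_sum Finset.univ _ (d : ℝ), Finset.sum_comm] at h1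
    have h2 : ∑ i, ∑ k : Fin d, a i * (∑ j, u i j * (b k : EuclideanSpace ℝ (Fin m)) j) ^ 2 ≤ A.card * ∑ i, a i := by
      rw [Finset.mul_sum]
      refine Finset.sum_le_sum fun i _ => ?_
      rw [← Finset.mul_sum, mul_comm]
      exact mul_le_mul_of_nonneg_right (hbes i) (ha i)
    have h3 : (0:ℝ) < d := by exact_mod_cast hdpos
    exact absurd h1 (not_lt.mpr (mul_le_mul_of_nonneg_left h2 h3.le))
  obtain ⟨k, hk⟩ := hex
  refine ⟨fun j => (b k : EuclideanSpace ℝ (Fin m)) j, hsupp k, ?_, ?_, ?_⟩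
  · have := hb.1 k
    have h2 : ‖(b k : EuclideanSpace ℝ (Fin m))‖ ^ 2 = 1 := by rw [this]; norm_num
    rw [EuclideanSpace.norm_sq_eq] at h2
    simpa using h2
  · intro w hw
    have := horth k (WithLp.toLp 2 w) (by
      simp only [F, Finset.mem_union, Finset.mem_image]
      exact Or.inl ⟨w, hw, rfl⟩)
    rw [hin] at this
    simpa using this
  · refine le_trans (mul_le_mul_of_nonneg_right ?_ ?_) hk
    · have : (A.card : ℝ) ≤ d + S.card := by exact_mod_cast hd
      linarith
    · exact Finset.sum_nonneg fun i _ => mul_nonneg (ha i) (sq_nonneg _)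

/-- Small moves in active directions stay in the cube. -/
lemma stay_in_cube {m : ℕ} (x y : Fin m → ℝ) (hx : ∀ j, |x j| ≤ 1)
    (hy : ∀ j, ¬ (|x j| < 1) → y j = 0) :
    ∀ᶠ e : ℝ in nhds 0, ∀ j, |x j + e * y j| ≤ 1 := by
  rw [Filter.eventually_all]
  intro j
  by_cases hj : |x j| < 1
  · have hc : Continuous fun e : ℝ => |x j + e * y j| := by fun_prop
    have := hc.tendsto 0
    simp only [zero_mul, add_zero] at this
    exact (this.eventually (gt_mem_nhds hj)).mono fun e he => he.le
  · simp [hy j hj, hx j]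

lemma compact_cube (m : ℕ) : IsCompact {x : Fin m → ℝ | ∀ j, |x j| ≤ 1} := by
  have : {x : Fin m → ℝ | ∀ j, |x j| ≤ 1} = Set.pi Set.univ fun _ => Set.Icc (-1:ℝ) 1 := by
    ext x; simp only [Set.mem_ofPred_eq, Set.mem_univ_pi, Set.mem_Icc, abs_le]
  rw [this]
  exact isCompact_univ_pi fun _ => isCompact_Icc

/-- Reduction to at most `T` fractional coordinates. -/
lemma linear_reduction {m T : ℕ} (v : Fin T → Fin m → ℝ) :
    ∃ x : Fin m → ℝ, (∀ j, |x j| ≤ 1) ∧ (∀ i, ∑ j, v i j * x j = 0) ∧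
      ∑ j, (1 - x j ^ 2) ≤ (T:ℝ) := by
  classical
  let K : Set (Fin m → ℝ) := {x | ∀ j, |x j| ≤ 1} ∩ {x | ∀ i, ∑ j, v i j * x j = 0}
  have hK : IsCompact K := by
    refine (compact_cube m).inter_right ?_
    simp only [Set.ofPred_forall]
    exact isClosed_iInter fun i => isClosed_eq (by fun_prop) continuous_const
  have hne : K.Nonempty := ⟨0, by simp [K]⟩
  obtain ⟨x, hxK, hmin⟩ := hK.exists_isMinOn hne
    (f := fun x => ∑ j, (1 - x j ^ 2)) (by fun_prop)
  refine ⟨x, hxK.1, hxK.2, ?_⟩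
  let A : Finset (Fin m) := Finset.univ.filter fun j => |x j| < 1
  have hqA : ∑ j, (1 - x j ^ 2) ≤ (A.card:ℝ) := by
    rw [Finset.card_eq_sum_ones, Nat.cast_sum, Finset.sum_filter]
    refine Finset.sum_le_sum fun j _ => ?_
    have h1 := hxK.1 j
    split_ifs with h
    · simp [sq_nonneg]
    · have : |x j| = 1 := le_antisymm h1 (not_lt.mp h)
      have : x j ^ 2 = 1 := by rw [← sq_abs, this]; norm_num
      simp [this]
  by_contra! hlt
  have hcard : T < A.card := by exact_mod_cast hlt.trans_le hqA
  obtain ⟨y, hyA, hy1, hyS, -⟩ := exists_direction (ι := Empty) A (Finset.univ.image v)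
    (lt_of_le_of_lt Finset.card_image_le (by simpa using hcard)) (fun i => i.elim)
    (fun i => i.elim) (fun i => i.elim) (fun i => i.elim)
  have hyA' : ∀ j, ¬ (|x j| < 1) → y j = 0 := fun j hj => hyA j (by simp [A]; simpa using hj)
  have h1 := stay_in_cube x y hxK.1 hyA'
  have h2 := stay_in_cube x (fun j => - y j) hxK.1 (fun j hj => by simp [hyA' j hj])
  obtain ⟨e, ⟨he1, he2⟩, he⟩ := ((h1.and h2).filter_mono nhdsWithin_le_nhds |>.and
    (self_mem_nhdsWithin : Set.Ioi (0:ℝ) ∈ nhdsWithin 0 (Set.Ioi 0))).exists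
  have he : 0 < e := he
  have hyv : ∀ i, ∑ j, v i j * y j = 0 := fun i => hyS _ (Finset.mem_image_of_mem _ (Finset.mem_univ i))
  have m1 := hmin (show (fun j => x j + e * y j) ∈ K from ⟨he1, fun i => by
    have := hxK.2 i
    have h3 := hyv i
    calc ∑ j, v i j * (x j + e * y j) = ∑ j, v i j * x j + e * ∑ j, v i j * y j := by
          rw [Finset.mul_sum, ← Finset.sum_add_distrib]
          exact Finset.sum_congr rfl fun j _ => by ring
      _ = 0 := by rw [this, h3]; ring⟩)
  have m2 := hmin (show (fun j => x j + e * -y j) ∈ K from ⟨he2, fun i => by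
    have := hxK.2 i
    have h3 := hyv i
    calc ∑ j, v i j * (x j + e * -y j) = ∑ j, v i j * x j - e * ∑ j, v i j * y j := by
          rw [Finset.mul_sum, ← Finset.sum_sub_distrib]
          exact Finset.sum_congr rfl fun j _ => by ring
      _ = 0 := by rw [this, h3]; ring⟩)
  simp only [Set.mem_ofPred_eq] at m1 m2
  have h4 : ∑ j, (1 - (x j + e * y j) ^ 2) + ∑ j, (1 - (x j + e * -y j) ^ 2) =
      2 * ∑ j, (1 - x j ^ 2) - 2 * e ^ 2 * ∑ j, y j ^ 2 := by
    rw [Finset.mul_sum, Finset.mul_sum, ← Finset.sum_add_distrib, ← Finset.sum_sub_distrib]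
    exact Finset.sum_congr rfl fun j _ => by ring
  rw [hy1] at h4
  nlinarith [sq_pos_of_pos he]

/-- Second order decrease of the barrier. -/
lemma barrier_decrease {ι : Type} [Fintype ι] (s w : ι → ℝ) (a : ℝ) (hs : ∀ i, 0 < s i)
    (h : ∑ i, 6 * (w i ^ 2 / s i ^ 4) < ∑ i, 4 * a * (1 / s i ^ 3)) :
    ∀ᶠ e : ℝ in nhdsWithin 0 (Set.Ioi 0),
      ∑ i, (1 / (s i + a * e ^ 2 - e * w i) ^ 2 + 1 / (s i + a * e ^ 2 + e * w i) ^ 2)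
        < 2 * ∑ i, 1 / s i ^ 2 := by
  let φ : ℝ → ℝ := fun t => ∑ i, 2 * ((s i + a * t) ^ 2 + t * w i ^ 2) /
    ((s i + a * t) ^ 2 - t * w i ^ 2) ^ 2
  have hder : HasDerivAt φ (∑ i, (6 * (w i ^ 2 / s i ^ 4) - 4 * a * (1 / s i ^ 3))) 0 := by
    refine HasDerivAt.fun_sum fun i _ => ?_
    have hsi := (hs i).ne'
    have e1 : HasDerivAt (fun t : ℝ => s i + a * t) a 0 := by
      simpa using ((hasDerivAt_id (0:ℝ)).const_mul a).const_add (s i)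
    have e2 : HasDerivAt (fun t : ℝ => t * w i ^ 2) (w i ^ 2) 0 := by
      simpa using (hasDerivAt_id (0:ℝ)).mul_const (w i ^ 2)
    have e3 := (((e1.fun_pow 2).fun_add e2).const_mul 2).fun_div
      (((e1.fun_pow 2).fun_sub e2).fun_pow 2) (by simp [hsi])
    refine HasDerivAt.congr_deriv e3 ?_
    simp
    field_simp
    ring
  have hneg : (∑ i, (6 * (w i ^ 2 / s i ^ 4) - 4 * a * (1 / s i ^ 3))) < 0 := by
    rw [Finset.sum_sub_distrib]; linarith
  have hφ : ∀ᶠ t : ℝ in nhdsWithin 0 (Set.Ioi 0), φ t < φ 0 := by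
    have h1 := hder.tendsto_slope
    have h2 := (h1.eventually (gt_mem_nhds hneg)).filter_mono
      (nhdsWithin_mono 0 (fun t (ht : 0 < t) => ht.ne'))
    filter_upwards [h2, self_mem_nhdsWithin] with t ht htpos
    have htpos : 0 < t := htpos
    rw [slope_def_field, sub_zero, div_lt_iff₀ htpos] at ht
    linarith
  have hsq : Filter.Tendsto (fun e : ℝ => e ^ 2) (nhdsWithin 0 (Set.Ioi 0))
      (nhdsWithin 0 (Set.Ioi 0)) := by
    refine tendsto_nhdsWithin_iff.mpr ⟨?_, ?_⟩
    · have : Filter.Tendsto (fun e : ℝ => e ^ 2) (nhds 0) (nhds 0) := by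
        have hc : Continuous fun e : ℝ => e ^ 2 := by fun_prop
        simpa using hc.tendsto 0
      exact this.mono_left nhdsWithin_le_nhds
    · filter_upwards [self_mem_nhdsWithin] with e he
      exact pow_pos (show 0 < e from he) 2
  have hpos : ∀ᶠ e : ℝ in nhdsWithin 0 (Set.Ioi 0), ∀ i,
      0 < s i + a * e ^ 2 - e * w i ∧ 0 < s i + a * e ^ 2 + e * w i := by
    refine Filter.Eventually.filter_mono nhdsWithin_le_nhds ?_
    rw [Filter.eventually_all]
    intro i
    have c1 : Continuous fun e : ℝ => s i + a * e ^ 2 - e * w i := by fun_prop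
    have c2 : Continuous fun e : ℝ => s i + a * e ^ 2 + e * w i := by fun_prop
    have t1 := c1.tendsto 0
    have t2 := c2.tendsto 0
    simp at t1 t2
    exact (t1.eventually (lt_mem_nhds (hs i))).and (t2.eventually (lt_mem_nhds (hs i)))
  filter_upwards [hsq.eventually hφ, hpos] with e he hp
  have h0 : φ 0 = 2 * ∑ i, 1 / s i ^ 2 := by
    simp only [φ, Finset.mul_sum]
    refine Finset.sum_congr rfl fun i _ => ?_
    have hsi := (hs i).ne'
    simp
    field_simp
  rw [h0] at he
  refine lt_of_le_of_lt (le_of_eq ?_) he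
  simp only [φ]
  refine Finset.sum_congr rfl fun i _ => ?_
  obtain ⟨p1, p2⟩ := hp i
  have : (s i + a * e ^ 2) ^ 2 - e ^ 2 * w i ^ 2 =
    (s i + a * e ^ 2 - e * w i) * (s i + a * e ^ 2 + e * w i) := by ring
  rw [this]
  have p1' := p1.ne'
  have p2' := p2.ne'
  rw [div_add_div _ _ (pow_ne_zero 2 p1') (pow_ne_zero 2 p2'), mul_pow]
  congr 1
  ring

set_option maxHeartbeats 1000000 in
/-- Main step: a cube point with at most one fractional coordinate and one-sided bounds. -/
lemma main_step {m T : ℕ} (hT : 0 < T) {ι : Type} [Fintype ι] [Nonempty ι]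
    (hι : Fintype.card ι ≤ 2 * T) (u : ι → Fin m → ℝ) (hu : ∀ i j, u i j ^ 2 = 1)
    (x₀ : Fin m → ℝ) (hx₀ : ∀ j, |x₀ j| ≤ 1) (hux₀ : ∀ i, ∑ j, u i j * x₀ j = 0)
    (hq₀ : ∑ j, (1 - x₀ j ^ 2) ≤ (T:ℝ)) :
    ∃ x : Fin m → ℝ, (∀ j, |x j| ≤ 1) ∧ (∀ i, ∑ j, u i j * x j ≤ 9 * Real.sqrt T) ∧
      (Finset.univ.filter fun j => |x j| < 1).card ≤ 1 := by
  classical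
  have hT1 : (1:ℝ) ≤ T := by exact_mod_cast hT
  have hsT : 1 ≤ Real.sqrt T := Real.one_le_sqrt.mpr hT1
  let q : (Fin m → ℝ) → ℝ := fun x => ∑ j, (1 - x j ^ 2)
  have hqc : Continuous q := by fun_prop
  let s : ι → (Fin m → ℝ) → ℝ := fun i x =>
    9 * Real.sqrt T - 5 * Real.sqrt (q x) - ∑ j, u i j * x j
  have hsc : ∀ i, Continuous (s i) := fun i => by
    have := Real.continuous_sqrt.comp hqc
    simp only [Function.comp_def] at this
    fun_prop
  let K : Set (Fin m → ℝ) := {x | ∀ j, |x j| ≤ 1} ∩ {x | ∀ i, 1 ≤ s i x}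
  have hK : IsCompact K := by
    refine (compact_cube m).inter_right ?_
    simp only [Set.ofPred_forall]
    exact isClosed_iInter fun i => isClosed_le continuous_const (hsc i)
  have hs0 : ∀ i, 4 * Real.sqrt T ≤ s i x₀ := by
    intro i
    simp only [s, hux₀]
    have := Real.sqrt_le_sqrt hq₀
    simp only [q]
    linarith
  have hx₀K : x₀ ∈ K := ⟨hx₀, fun i => by have := hs0 i; linarith⟩
  let G : (Fin m → ℝ) → ℝ := fun x => ∑ i, 1 / s i x ^ 2
  have hGc : ContinuousOn G K := by
    refine continuousOn_finsetSum _ fun i _ => ?_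
    refine ContinuousOn.div continuousOn_const ((hsc i).pow 2).continuousOn fun x hx => ?_
    have := hx.2 i
    positivity
  obtain ⟨x, hxK, hmin⟩ := hK.exists_isMinOn ⟨x₀, hx₀K⟩ hGc
  have hG : G x ≤ 1 / 8 := by
    refine (hmin hx₀K).trans ?_
    calc G x₀ ≤ ∑ i : ι, 1 / (16 * (T:ℝ)) := by
          refine Finset.sum_le_sum fun i _ => ?_
          refine one_div_le_one_div_of_le (by positivity) ?_
          have h1 := hs0 i
          have h2 : Real.sqrt T ^ 2 = T := Real.sq_sqrt (by positivity)
          nlinarith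
      _ = Fintype.card ι * (1 / (16 * (T:ℝ))) := by simp
      _ ≤ (2 * T) * (1 / (16 * (T:ℝ))) := by
          refine mul_le_mul_of_nonneg_right ?_ (by positivity)
          exact_mod_cast hι
      _ = 1 / 8 := by field_simp; norm_num
  have hspos : ∀ i, 0 < s i x := fun i => by have := hxK.2 i; linarith
  have hsgt : ∀ i, 1 < s i x := by
    intro i
    have h1 : 1 / s i x ^ 2 ≤ 1 / 8 := le_trans
      (Finset.single_le_sum (f := fun i => 1 / s i x ^ 2) (fun i _ => by positivity)
        (Finset.mem_univ i)) hG
    have h2 := (one_div_le_one_div (by have := hspos i; positivity) (by norm_num)).mp h1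
    nlinarith [hspos i]
  refine ⟨x, hxK.1, fun i => ?_, ?_⟩
  · have h1 := hspos i
    simp only [s] at h1
    have := Real.sqrt_nonneg (q x)
    linarith
  by_contra! hcard
  set A : Finset (Fin m) := Finset.univ.filter fun j => |x j| < 1 with hA
  set n := A.card with hn
  have hterm : ∀ z : Fin m → ℝ, (∀ j, |z j| ≤ 1) → ∀ j, 0 ≤ 1 - z j ^ 2 := by
    intro z hz j
    have := (sq_le_one_iff_abs_le_one (z j)).mpr (hz j)
    linarith
  have hqA : q x ≤ n := by
    rw [hn, Finset.card_eq_sum_ones, Nat.cast_sum, Finset.sum_filter]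
    refine Finset.sum_le_sum fun j _ => ?_
    have h1 := hxK.1 j
    split_ifs with h
    · simp [sq_nonneg]
    · have : |x j| = 1 := le_antisymm h1 (not_lt.mp h)
      have : x j ^ 2 = 1 := by rw [← sq_abs, this]; norm_num
      simp [this]
  have hqpos : 0 < q x := by
    obtain ⟨j, hj⟩ : A.Nonempty := Finset.card_pos.mp (by omega)
    have hj : |x j| < 1 := by simpa [hA] using hj
    refine Finset.sum_pos' (fun j _ => hterm x hxK.1 j) ⟨j, Finset.mem_univ j, ?_⟩
    have := (sq_lt_one_iff_abs_lt_one (x j)).mpr hj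
    linarith
  have hnpos : (0:ℝ) < n := by linarith
  have hsn : 0 < Real.sqrt n := Real.sqrt_pos.mpr hnpos
  have hsn2 : Real.sqrt n ^ 2 = n := Real.sq_sqrt hnpos.le
  set σ := 19 / 10 * Real.sqrt n with hσ
  have hσpos : 0 < σ := by positivity
  let D : Finset ι := Finset.univ.filter fun i => s i x < σ
  have hD : 2 * D.card < n := by
    have h1 : (D.card : ℝ) * (1 / σ ^ 2) ≤ 1 / 8 := by
      refine le_trans ?_ hG
      calc (D.card : ℝ) * (1 / σ ^ 2) = ∑ i ∈ D, 1 / σ ^ 2 := by simp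
        _ ≤ ∑ i ∈ D, 1 / s i x ^ 2 := by
            refine Finset.sum_le_sum fun i hi => ?_
            have hi : s i x < σ := by simpa [D] using hi
            have := hspos i
            exact one_div_le_one_div_of_le (by positivity) (by gcongr)
        _ ≤ G x := Finset.sum_le_sum_of_subset_of_nonneg (Finset.subset_univ _)
            fun i _ _ => by positivity
    have h2 : (D.card : ℝ) ≤ 1 / 8 * σ ^ 2 := by
      rw [mul_one_div, div_le_iff₀ (by positivity)] at h1
      exact h1
    have h3 : (2 * D.card : ℝ) < n := by
      have : σ ^ 2 = 361 / 100 * n := by rw [hσ, mul_pow, hsn2]; norm_num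
      rw [this] at h2
      linarith
    exact_mod_cast h3
  let S : Finset (Fin m → ℝ) := insert x (D.image u)
  have hScard : S.card ≤ D.card + 1 :=
    (Finset.card_insert_le _ _).trans (Nat.add_le_add_right Finset.card_image_le 1)
  have hS1 : S.card < n := by omega
  have hS2 : n ≤ 3 * (n - S.card) := by omega
  let α : ι → ℝ := fun i => if i ∈ D then 0 else 1 / s i x ^ 4
  have hα : ∀ i, 0 ≤ α i := by
    intro i; simp only [α]; split_ifs <;> positivity
  obtain ⟨y, hyA, hy1, hyS, hyq⟩ := exists_direction A S hS1 u hu α hα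
  have hyx : ∑ j, x j * y j = 0 := hyS x (Finset.mem_insert_self _ _)
  let w : ι → ℝ := fun i => ∑ j, u i j * y j
  have hwD : ∀ i ∈ D, w i = 0 := fun i hi =>
    hyS _ (Finset.mem_insert_of_mem (Finset.mem_image_of_mem _ hi))
  have hquad : ∑ i, α i * w i ^ 2 ≤ 3 * ∑ i, α i := by
    have h1 : (n:ℝ) ≤ 3 * ((n:ℝ) - S.card) := by
      have : (n:ℝ) ≤ 3 * ((n - S.card : ℕ) : ℝ) := by exact_mod_cast hS2
      rwa [Nat.cast_sub hS1.le] at this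
    have h2 : 0 ≤ ∑ i, α i * w i ^ 2 :=
      Finset.sum_nonneg fun i _ => mul_nonneg (hα i) (sq_nonneg _)
    have h3 : 0 ≤ ∑ i, α i := Finset.sum_nonneg fun i _ => hα i
    have h4 : (n:ℝ) * ∑ i, α i * w i ^ 2 ≤ n * (3 * ∑ i, α i) := by
      calc (n:ℝ) * ∑ i, α i * w i ^ 2 ≤ (3 * ((n:ℝ) - S.card)) * ∑ i, α i * w i ^ 2 :=
            mul_le_mul_of_nonneg_right h1 h2
        _ = 3 * (((n:ℝ) - S.card) * ∑ i, α i * w i ^ 2) := by ring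
        _ ≤ 3 * (n * ∑ i, α i) := by
            exact mul_le_mul_of_nonneg_left hyq (by norm_num)
        _ = _ := by ring
    exact le_of_mul_le_mul_left h4 hnpos
  have hsq : 0 < Real.sqrt (q x) := Real.sqrt_pos.mpr hqpos
  set a := 5 / (2 * Real.sqrt (q x)) with ha
  have hcub : 0 < ∑ i, 1 / s i x ^ 3 :=
    Finset.sum_pos (fun i _ => by have := hspos i; positivity) Finset.univ_nonempty
  have hkey : ∑ i, 6 * (w i ^ 2 / s i x ^ 4) < ∑ i, 4 * a * (1 / s i x ^ 3) := by
    have h1 : ∑ i, 6 * (w i ^ 2 / s i x ^ 4) = 6 * ∑ i, α i * w i ^ 2 := by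
      rw [Finset.mul_sum]
      refine Finset.sum_congr rfl fun i _ => ?_
      by_cases hi : i ∈ D
      · simp [hwD i hi]
      · simp only [α, hi, if_false]; ring
    have h2 : ∑ i, α i ≤ (1 / σ) * ∑ i, 1 / s i x ^ 3 := by
      rw [Finset.mul_sum]
      refine Finset.sum_le_sum fun i _ => ?_
      have hp := hspos i
      by_cases hi : i ∈ D
      · simp only [α, hi, if_true]; positivity
      · simp only [α, hi, if_false]
        have hi : σ ≤ s i x := by simpa [D] using hi
        rw [div_mul_div_comm, one_mul]
        refine one_div_le_one_div_of_le (by positivity) ?_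
        calc σ * s i x ^ 3 ≤ s i x * s i x ^ 3 := by gcongr
          _ = s i x ^ 4 := by ring
    have h3 : 18 * (1 / σ) < 4 * a := by
      have : Real.sqrt (q x) ≤ Real.sqrt n := Real.sqrt_le_sqrt hqA
      rw [ha, hσ, mul_one_div, ← mul_div_assoc, div_lt_div_iff₀ (by positivity) (by positivity)]
      nlinarith
    rw [h1, ← Finset.mul_sum]
    calc 6 * ∑ i, α i * w i ^ 2 ≤ 6 * (3 * ((1 / σ) * ∑ i, 1 / s i x ^ 3)) := by
          linarith
      _ = (18 * (1 / σ)) * ∑ i, 1 / s i x ^ 3 := by ring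
      _ < 4 * a * ∑ i, 1 / s i x ^ 3 := mul_lt_mul_of_pos_right h3 hcub
  have hdec := barrier_decrease (fun i => s i x) w a hspos hkey
  have hyA' : ∀ j, ¬ (|x j| < 1) → y j = 0 := fun j hj => hyA j (by simp [hA]; simpa using hj)
  have c1 := (stay_in_cube x y hxK.1 hyA').filter_mono
    (nhdsWithin_le_nhds (s := Set.Ioi (0:ℝ)))
  have c2 := (stay_in_cube x (fun j => - y j) hxK.1
    (fun j hj => by simp [hyA' j hj])).filter_mono (nhdsWithin_le_nhds (s := Set.Ioi (0:ℝ)))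
  have hpos : ∀ᶠ e : ℝ in nhdsWithin 0 (Set.Ioi 0), ∀ i,
      1 < s i x + a * e ^ 2 - e * w i ∧ 1 < s i x + a * e ^ 2 + e * w i := by
    refine Filter.Eventually.filter_mono nhdsWithin_le_nhds ?_
    rw [Filter.eventually_all]
    intro i
    have c1 : Continuous fun e : ℝ => s i x + a * e ^ 2 - e * w i := by fun_prop
    have c2 : Continuous fun e : ℝ => s i x + a * e ^ 2 + e * w i := by fun_prop
    have t1 := c1.tendsto 0
    have t2 := c2.tendsto 0
    simp at t1 t2
    exact (t1.eventually (lt_mem_nhds (hsgt i))).and (t2.eventually (lt_mem_nhds (hsgt i)))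
  obtain ⟨e, hde, hc1, hc2, hp⟩ := (hdec.and (c1.and (c2.and hpos))).exists
  have hslack : ∀ t : ℝ, t ^ 2 = e ^ 2 → (∀ j, |x j + t * y j| ≤ 1) → ∀ i,
      s i x + a * e ^ 2 - t * w i ≤ s i (fun j => x j + t * y j) := by
    intro t ht hcube i
    have hq : q (fun j => x j + t * y j) = q x - e ^ 2 := by
      have : q (fun j => x j + t * y j) =
          q x - 2 * t * ∑ j, x j * y j - t ^ 2 * ∑ j, y j ^ 2 := by
        simp only [q]
        rw [Finset.mul_sum, Finset.mul_sum, ← Finset.sum_sub_distrib, ← Finset.sum_sub_distrib]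
        exact Finset.sum_congr rfl fun j _ => by ring
      rw [this, hyx, hy1, ht]; ring
    have hq0 : 0 ≤ q x - e ^ 2 := by
      rw [← hq]; exact Finset.sum_nonneg fun j _ => hterm _ hcube j
    have hlin : ∑ j, u i j * (x j + t * y j) = ∑ j, u i j * x j + t * w i := by
      simp only [w]
      rw [Finset.mul_sum, ← Finset.sum_add_distrib]
      exact Finset.sum_congr rfl fun j _ => by ring
    have hsqrt : a * e ^ 2 ≤ 5 * Real.sqrt (q x) - 5 * Real.sqrt (q x - e ^ 2) := by
      have r1 := Real.sq_sqrt hqpos.le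
      have r2 := Real.sq_sqrt hq0
      rw [ha, div_mul_eq_mul_div, div_le_iff₀ (by positivity)]
      nlinarith [sq_nonneg (Real.sqrt (q x) - Real.sqrt (q x - e ^ 2))]
    simp only [s, hq, hlin]
    linarith
  have hc2' : ∀ j, |x j + (-e) * y j| ≤ 1 := fun j => by
    have := hc2 j
    rwa [mul_neg, ← neg_mul] at this
  have s1 := hslack e rfl hc1
  have s2 := hslack (-e) (by ring) hc2'
  have m1 := hmin (show (fun j => x j + e * y j) ∈ K from
    ⟨hc1, fun i => by have := s1 i; have := (hp i).1; linarith⟩)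
  have m2 := hmin (show (fun j => x j + (-e) * y j) ∈ K from
    ⟨hc2', fun i => by have := s2 i; have := (hp i).2; linarith⟩)
  simp only [Set.mem_ofPred_eq] at m1 m2
  have g1 : G (fun j => x j + e * y j) ≤ ∑ i, 1 / (s i x + a * e ^ 2 - e * w i) ^ 2 := by
    refine Finset.sum_le_sum fun i _ => ?_
    have h1 := (hp i).1
    have h0 : 0 < s i x + a * e ^ 2 - e * w i := by linarith
    exact one_div_le_one_div_of_le (by positivity) (pow_le_pow_left₀ h0.le (s1 i) 2)
  have g2 : G (fun j => x j + (-e) * y j) ≤ ∑ i, 1 / (s i x + a * e ^ 2 + e * w i) ^ 2 := by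
    refine Finset.sum_le_sum fun i _ => ?_
    have h1 := (hp i).2
    have h0 : 0 < s i x + a * e ^ 2 + e * w i := by linarith
    have := s2 i
    exact one_div_le_one_div_of_le (by positivity)
      (pow_le_pow_left₀ h0.le (by linarith) 2)
  rw [Finset.sum_add_distrib] at hde
  have : G x = ∑ i, 1 / s i x ^ 2 := rfl
  linarith

/-- For any `T` vectors `v₁, …, v_T ∈ {-1,1}^m`, there is a vector `x ∈ {-1,1}^m` whose
inner product with each `vᵢ` is at most `12√T` in absolute value. -/
theorem signVectors_low_discrepancy (m T : ℕ) (hm : 0 < m)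
    (v : Fin T → Fin m → ℝ) (hv : ∀ i j, v i j = 1 ∨ v i j = -1) :
    ∃ x : Fin m → ℝ, (∀ j, x j = 1 ∨ x j = -1) ∧
      ∀ i, |∑ j, v i j * x j| ≤ 12 * Real.sqrt T := by
  classical
  rcases Nat.eq_zero_or_pos T with rfl | hT
  · exact ⟨fun _ => 1, fun _ => Or.inl rfl, fun i => i.elim0⟩
  have hT1 : (1:ℝ) ≤ T := by exact_mod_cast hT
  have hsT : 1 ≤ Real.sqrt T := Real.one_le_sqrt.mpr hT1
  obtain ⟨x₀, h1, h2, h3⟩ := linear_reduction v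
  have : Nonempty (Fin T ⊕ Fin T) := ⟨Sum.inl ⟨0, hT⟩⟩
  obtain ⟨x, hx, hd, hc⟩ := main_step hT (ι := Fin T ⊕ Fin T) (by simp; omega)
    (Sum.elim v (fun i j => - v i j))
    (by rintro (i | i) j <;> rcases hv i j with h | h <;> simp [h]) x₀ h1
    (by rintro (i | i) <;> simp [h2]) h3
  let z : Fin m → ℝ := fun j => if 0 ≤ x j then 1 else -1
  have hz : ∀ j, z j = 1 ∨ z j = -1 := fun j => by
    simp only [z]; split_ifs <;> simp
  refine ⟨z, hz, fun i => ?_⟩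
  have hdiff : |∑ j, v i j * (z j - x j)| ≤ 1 := by
    refine (Finset.abs_sum_le_sum_abs _ _).trans ?_
    have : ∑ j, |v i j * (z j - x j)| ≤ ∑ j, if |x j| < 1 then (1:ℝ) else 0 := by
      refine Finset.sum_le_sum fun j _ => ?_
      have hv1 : |v i j| = 1 := by rcases hv i j with h | h <;> simp [h]
      rw [abs_mul, hv1, one_mul]
      have hxj := abs_le.mp (hx j)
      simp only [z]
      split_ifs with g1 g2 g2
      · rw [abs_le]; constructor <;> linarith
      · rw [abs_of_nonneg g1] at g2
        rw [abs_le]; constructor <;> linarith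
      · rw [abs_le]; constructor <;> linarith
      · rw [abs_of_neg (not_le.mp g1)] at g2
        rw [abs_le]; constructor <;> linarith
    refine this.trans ?_
    rw [Finset.sum_boole]
    exact_mod_cast hc
  have hp := hd (Sum.inl i)
  have hn := hd (Sum.inr i)
  simp only [Sum.elim_inl, Sum.elim_inr, neg_mul, Finset.sum_neg_distrib] at hp hn
  have hsplit : ∑ j, v i j * z j = ∑ j, v i j * (z j - x j) + ∑ j, v i j * x j := by
    rw [← Finset.sum_add_distrib]
    exact Finset.sum_congr rfl fun j _ => by ring
  rw [abs_le] at hdiff ⊢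
  rw [hsplit]
  constructor <;> linarith
end

section
/- Let G = (V,E) be a graph with n vertices and independence number α(G) = (1/4 + ε)n, where ε is a real number with 0 < ε < 1/4. Then the average, over all 2^n subsets W of V chosen uniformly at random, of the independence number of the induced subgraph of G on W is at most (1/4 + ε − ε^2/3)·n; that is, (1/2^n) · ∑_{W ⊆ V} α(G[W]) ≤ (1/4 + ε − ε^2/3)·n. -/
/-- A finset of vertices is independent: no two of its elements are adjacent. -/
def IsIndepF {V : Type*} (G : SimpleGraph V) (s : Finset V) : Prop :=
  ∀ a ∈ s, ∀ b ∈ s, ¬ G.Adj a b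

/-- The independence number of a finite graph: the maximum size of an independent set. -/
noncomputable def indepNum {V : Type*} [Fintype V] (G : SimpleGraph V) : ℕ :=
  sSup {n | ∃ s : Finset V, IsIndepF G s ∧ s.card = n}

/-- A maximum independent set: an independent set whose size is the independence number. -/
def IsMaxIndep {V : Type*} [Fintype V] (G : SimpleGraph V) (s : Finset V) : Prop :=
  IsIndepF G s ∧ s.card = indepNum G


open Finset

/-- `f W` is the maximum size of an independent subset of `W`. -/
def IsAlphaFun {V : Type*} (G : SimpleGraph V) (f : Finset V → ℕ) : Prop :=
  (∀ W, ∃ s ⊆ W, IsIndepF G s ∧ s.card = f W) ∧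
    ∀ W, ∀ s ⊆ W, IsIndepF G s → s.card ≤ f W

lemma indepNum_spec {V : Type*} [Fintype V] (G : SimpleGraph V) :
    (∃ s, IsIndepF G s ∧ s.card = indepNum G) ∧
      ∀ s, IsIndepF G s → s.card ≤ indepNum G := by
  have hb : BddAbove {n | ∃ s : Finset V, IsIndepF G s ∧ s.card = n} := by
    refine ⟨Fintype.card V, ?_⟩
    rintro n ⟨s, -, rfl⟩
    exact Finset.card_le_univ s
  refine ⟨?_, fun s hs => le_csSup hb ⟨s, hs, rfl⟩⟩
  have hne : {n | ∃ s : Finset V, IsIndepF G s ∧ s.card = n}.Nonempty :=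
    ⟨0, ∅, by intro a ha; simp at ha, rfl⟩
  exact Nat.sSup_mem hne hb

lemma isAlphaFun_induce {V : Type*} [Fintype V] (G : SimpleGraph V) :
    IsAlphaFun G (fun W : Finset V => indepNum (G.induce (W : Set V))) := by
  classical
  constructor
  · intro W
    obtain ⟨s, hs, hc⟩ := (indepNum_spec (G.induce (W : Set V))).1
    refine ⟨s.map (Function.Embedding.subtype _), ?_, ?_, by simpa using hc⟩
    · intro x hx
      simp only [Finset.mem_map] at hx
      obtain ⟨y, -, rfl⟩ := hx
      exact y.2
    · intro a ha b hb hab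
      simp only [Finset.mem_map] at ha hb
      obtain ⟨a, ha, rfl⟩ := ha
      obtain ⟨b, hb, rfl⟩ := hb
      exact hs a ha b hb hab
  · intro W s hs hi
    have h := (indepNum_spec (G.induce (W : Set V))).2
      (s.subtype (fun x => x ∈ (W : Set V))) (by
        intro a ha b hb hab
        rw [Finset.mem_subtype] at ha hb
        exact hi _ ha _ hb hab)
    rw [Finset.card_subtype] at h
    have e : s.filter (fun x => x ∈ (W : Set V)) = s :=
      Finset.filter_true_of_mem (fun x hx => hs hx)
    rw [e] at h
    exact h

section
variable {V : Type*} [DecidableEq V] {G : SimpleGraph V} {f : Finset V → ℕ}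

lemma IsAlphaFun.family (hf : IsAlphaFun G f) (W : Finset V) (F : Finset (Finset V))
    (hF : F.Nonempty) (h : ∀ S ∈ F, S ⊆ W ∧ IsIndepF G S ∧ S.card = f W) :
    2 * f W ≤ (F.biUnion id).card + (W.filter (fun v => ∀ S ∈ F, v ∈ S)).card := by
  induction hF using Finset.Nonempty.cons_induction with
  | singleton S =>
    obtain ⟨h1, -, h3⟩ := h S (by simp)
    have : W.filter (fun v => ∀ S' ∈ ({S} : Finset (Finset V)), v ∈ S') = S := by
      ext v; simp; exact fun hv => h1 hv
    rw [this]; simp; omega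
  | cons S F hS hne ih =>
    have ih := ih (fun S' hS' => h S' (by simp [hS']))
    obtain ⟨h1, h2, h3⟩ := h S (by simp)
    have e1 : (Finset.cons S F hS).biUnion id = S ∪ F.biUnion id := by
      ext v; simp
    set T := W.filter (fun v => ∀ S ∈ F, v ∈ S) with hT
    have e2 : W.filter (fun v => ∀ S' ∈ Finset.cons S F hS, v ∈ S') = S ∩ T := by
      ext v; simp [hT]; tauto
    rw [e1, e2]
    set U := F.biUnion id with hU
    have hUW : U ⊆ W := by
      intro v hv
      simp only [hU, Finset.mem_biUnion, id] at hv
      obtain ⟨S', hS', hv⟩ := hv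
      exact (h S' (by simp [hS'])).1 hv
    have key : ∀ x ∈ T, ∀ y ∈ U, ¬ G.Adj x y := by
      intro x hx y hy
      simp only [hU, Finset.mem_biUnion, id] at hy
      obtain ⟨S', hS', hy⟩ := hy
      have hx' := (Finset.mem_filter.1 hx).2 S' hS'
      exact (h S' (by simp [hS'])).2.1 x hx' y hy
    have hTU : T ⊆ U := by
      intro v hv
      obtain ⟨S', hS'⟩ := hne
      exact Finset.mem_biUnion.2 ⟨S', hS', (Finset.mem_filter.1 hv).2 S' hS'⟩
    have hle := hf.2 W ((S ∩ U) ∪ T) (by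
      apply Finset.union_subset
      · exact Finset.inter_subset_left.trans h1
      · exact hTU.trans hUW) (by
      intro a ha b hb hab
      rw [Finset.mem_union, Finset.mem_inter] at ha hb
      rcases ha with ha | ha
      · rcases hb with hb | hb
        · exact h2 a ha.1 b hb.1 hab
        · exact key b hb a ha.2 hab.symm
      · rcases hb with hb | hb
        · exact key a ha b hb.2 hab
        · exact key a ha b (hTU hb) hab)
    have c1 := Finset.card_union_add_card_inter (S ∩ U) T
    have c2 := Finset.card_union_add_card_inter S U
    have c3 : S ∩ U ∩ T = S ∩ T := by
      rw [Finset.inter_assoc, Finset.inter_eq_right.2 hTU]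
    rw [c3] at c1
    omega

lemma IsAlphaFun.mono (hf : IsAlphaFun G f) {A B : Finset V} (h : A ⊆ B) : f A ≤ f B := by
  obtain ⟨s, hs, hi, hc⟩ := hf.1 A
  exact hc ▸ hf.2 B s (hs.trans h) hi

lemma IsAlphaFun.le_card (hf : IsAlphaFun G f) (A : Finset V) : f A ≤ A.card := by
  obtain ⟨s, hs, hi, hc⟩ := hf.1 A
  exact hc ▸ Finset.card_le_card hs

lemma IsAlphaFun.core (hf : IsAlphaFun G f) (W : Finset V) :
    2 * f W ≤ W.card + (W.filter (fun v => f (W.erase v) < f W)).card := by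
  classical
  set F := W.powerset.filter (fun S => IsIndepF G S ∧ S.card = f W) with hFdef
  have hmem : ∀ S ∈ F, S ⊆ W ∧ IsIndepF G S ∧ S.card = f W := by
    intro S hS
    rw [hFdef, Finset.mem_filter, Finset.mem_powerset] at hS
    exact hS
  have hne : F.Nonempty := by
    obtain ⟨s, hs, hi, hc⟩ := hf.1 W
    exact ⟨s, by rw [hFdef, Finset.mem_filter, Finset.mem_powerset]; exact ⟨hs, hi, hc⟩⟩
  have h := hf.family W F hne hmem
  have h1 : (F.biUnion id).card ≤ W.card := by
    apply Finset.card_le_card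
    intro v hv
    simp only [Finset.mem_biUnion, id] at hv
    obtain ⟨S, hS, hv⟩ := hv
    exact (hmem S hS).1 hv
  have h2 : (W.filter (fun v => ∀ S ∈ F, v ∈ S)).card ≤
      (W.filter (fun v => f (W.erase v) < f W)).card := by
    apply Finset.card_le_card
    intro v hv
    rw [Finset.mem_filter] at hv ⊢
    refine ⟨hv.1, lt_of_le_of_ne (hf.mono (Finset.erase_subset _ _)) ?_⟩
    intro heq
    obtain ⟨s, hs, hi, hc⟩ := hf.1 (W.erase v)
    have : s ∈ F := by
      rw [hFdef, Finset.mem_filter, Finset.mem_powerset]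
      exact ⟨hs.trans (Finset.erase_subset _ _), hi, hc.trans heq⟩
    exact Finset.notMem_erase v W (hs (hv.2 s this))
  omega

/-- vertex cover number -/
def tauF (f : Finset V → ℕ) (W : Finset V) : ℝ := (W.card : ℝ) - f W

lemma IsAlphaFun.tau_nonneg (hf : IsAlphaFun G f) (W : Finset V) : 0 ≤ tauF f W := by
  have : (f W : ℝ) ≤ W.card := by exact_mod_cast hf.le_card W
  unfold tauF; linarith

lemma IsAlphaFun.tau_erase (hf : IsAlphaFun G f) (W : Finset V) :
    ((W.card : ℝ) - 2) * tauF f W ≤ ∑ v ∈ W, tauF f (W.erase v) := by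
  have h : ∀ v ∈ W, (W.card : ℝ) - 1 - f W + (if f (W.erase v) < f W then 1 else 0) ≤
      tauF f (W.erase v) := by
    intro v hv
    have hc : ((W.erase v).card : ℝ) = W.card - 1 := by
      rw [Finset.card_erase_of_mem hv, Nat.cast_sub (Finset.card_pos.2 ⟨v, hv⟩)]; simp
    unfold tauF
    rw [hc]
    split_ifs with hlt
    · have : (f (W.erase v) : ℝ) + 1 ≤ f W := by exact_mod_cast hlt
      linarith
    · have : (f (W.erase v) : ℝ) ≤ f W := by
        exact_mod_cast hf.mono (Finset.erase_subset _ _)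
      linarith
  refine le_trans ?_ (Finset.sum_le_sum h)
  rw [Finset.sum_add_distrib, Finset.sum_const, nsmul_eq_mul, Finset.sum_boole]
  have hc : (2 : ℝ) * f W ≤ W.card + (W.filter (fun v => f (W.erase v) < f W)).card := by
    exact_mod_cast hf.core W
  unfold tauF
  nlinarith

lemma sum_erase_psc (g : Finset V → ℝ) (U : Finset V) (k : ℕ) :
    ∑ v ∈ U, ∑ W ∈ (U.erase v).powersetCard k, g W =
      ((U.card : ℝ) - k) * ∑ W ∈ U.powersetCard k, g W := by
  have : ∑ v ∈ U, ∑ W ∈ (U.erase v).powersetCard k, g W =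
      ∑ W ∈ U.powersetCard k, ∑ v ∈ U \ W, g W := by
    apply Finset.sum_comm'
    intro v W
    simp only [Finset.mem_powersetCard, Finset.mem_sdiff, Finset.subset_erase]
    tauto
  rw [this, Finset.mul_sum]
  apply Finset.sum_congr rfl
  intro W hW
  rw [Finset.mem_powersetCard] at hW
  rw [Finset.sum_const, nsmul_eq_mul, Finset.card_sdiff_of_subset hW.1,
    Nat.cast_sub (Finset.card_le_card hW.1), hW.2]

lemma IsAlphaFun.layer (hf : IsAlphaFun G f) (j d : ℕ) : ∀ U : Finset V, U.card = j + 2 + d →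
    ((j + d).choose d : ℝ) * tauF f U ≤ ∑ W ∈ U.powersetCard (j + 2), tauF f W := by
  induction d with
  | zero =>
    intro U hU
    have : U.powersetCard (j + 2) = {U} := by
      rw [← show U.card = j + 2 from hU, Finset.powersetCard_self]
    rw [this]; simp
  | succ d ih =>
    intro U hU
    have h1 : ((j + d).choose d : ℝ) * ∑ v ∈ U, tauF f (U.erase v) ≤
        ∑ v ∈ U, ∑ W ∈ (U.erase v).powersetCard (j + 2), tauF f W := by
      rw [Finset.mul_sum]
      apply Finset.sum_le_sum
      intro v hv
      apply ih
      rw [Finset.card_erase_of_mem hv]; omega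
    rw [sum_erase_psc] at h1
    have h2 := mul_le_mul_of_nonneg_left (hf.tau_erase U)
      (show (0 : ℝ) ≤ ((j + d).choose d : ℝ) by positivity)
    have h3 : ((j : ℝ) + d + 1) * ((j + d).choose d : ℝ) =
        ((j + (d + 1)).choose (d + 1) : ℝ) * (d + 1) := by
      exact_mod_cast Nat.add_one_mul_choose_eq (j + d) d
    rw [hU] at h1 h2
    push_cast at h1 h2
    have hd : (0 : ℝ) < d + 1 := by positivity
    refine le_of_mul_le_mul_left ?_ hd
    calc ((d : ℝ) + 1) * (((j + (d + 1)).choose (d + 1) : ℝ) * tauF f U)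
        = ((j : ℝ) + d + 1) * ((j + d).choose d : ℝ) * tauF f U := by rw [h3]; ring
      _ = ((j + d).choose d : ℝ) * (((j : ℝ) + 2 + (d + 1) - 2) * tauF f U) := by ring
      _ ≤ _ := h2
      _ ≤ _ := h1
      _ = _ := by ring

lemma IsAlphaFun.tau_small (hf : IsAlphaFun G f) (U : Finset V) (hU : U.card < 2) :
    tauF f U = 0 := by
  have h := hf.2 U U subset_rfl (by
    intro a ha b hb hab
    have := Finset.card_le_one.1 (Nat.lt_succ_iff.1 hU) a ha b hb
    subst this
    exact G.loopless.irrefl _ hab)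
  have h' := hf.le_card U
  have : f U = U.card := le_antisymm h' h
  simp [tauF, this]

lemma IsAlphaFun.sample (hf : IsAlphaFun G f) (U : Finset V) (q : ℝ) (h0 : 0 ≤ q) (h1 : q ≤ 1) :
    q ^ 2 * tauF f U ≤
      ∑ W ∈ U.powerset, q ^ W.card * (1 - q) ^ (U.card - W.card) * tauF f W := by
  have hq : 0 ≤ 1 - q := by linarith
  rcases lt_or_ge U.card 2 with hU | hU
  · rw [hf.tau_small U hU, mul_zero]
    exact Finset.sum_nonneg fun W _ => mul_nonneg (by positivity) (hf.tau_nonneg W)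
  obtain ⟨s, hs⟩ := Nat.exists_eq_add_of_le' hU
  rw [Finset.sum_powerset, hs, Finset.sum_range_succ', Finset.sum_range_succ']
  have hnn : ∀ k, 0 ≤ ∑ W ∈ U.powersetCard k,
      q ^ W.card * (1 - q) ^ (s + 2 - W.card) * tauF f W := fun k =>
    Finset.sum_nonneg fun W _ => mul_nonneg (by positivity) (hf.tau_nonneg W)
  have hmain : q ^ 2 * tauF f U ≤ ∑ k ∈ Finset.range (s + 1),
      ∑ W ∈ U.powersetCard (k + 1 + 1),
        q ^ W.card * (1 - q) ^ (s + 2 - W.card) * tauF f W := by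
    have e : q ^ 2 * tauF f U = ∑ k ∈ Finset.range (s + 1),
        q ^ (k + 2) * (1 - q) ^ (s - k) * ((s.choose k : ℝ) * tauF f U) := by
      have := add_pow q (1 - q) s
      rw [add_sub_cancel, one_pow] at this
      calc q ^ 2 * tauF f U = q ^ 2 * tauF f U * 1 := by ring
        _ = _ := by
          conv_lhs => rw [this, Finset.mul_sum]
          apply Finset.sum_congr rfl
          intro k _
          ring
    rw [e]
    apply Finset.sum_le_sum
    intro k hk
    have hk : k ≤ s := Nat.lt_succ_iff.1 (Finset.mem_range.1 hk)
    obtain ⟨d, rfl⟩ := Nat.exists_eq_add_of_le hk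
    have e2 : ∑ W ∈ U.powersetCard (k + 1 + 1),
        q ^ W.card * (1 - q) ^ (k + d + 2 - W.card) * tauF f W =
        q ^ (k + 2) * (1 - q) ^ (k + d - k) * ∑ W ∈ U.powersetCard (k + 2), tauF f W := by
      rw [Finset.mul_sum]
      apply Finset.sum_congr rfl
      intro W hW
      rw [(Finset.mem_powersetCard.1 hW).2]
      congr 3
      omega
    rw [e2]
    apply mul_le_mul_of_nonneg_left _ (by positivity)
    have := hf.layer k d U (by omega)
    rwa [Nat.choose_symm_add]
  have := hnn 0
  have := hnn (0 + 1)
  linarith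

end

lemma mean_card {V : Type*} [Fintype V] (p : ℝ) :
    ∑ U : Finset V, p ^ U.card * (1 - p) ^ (Fintype.card V - U.card) * (U.card : ℝ) =
      p * Fintype.card V := by
  have h := Finset.sum_powerset_apply_card
    (fun k => p ^ k * (1 - p) ^ (Fintype.card V - k) * (k : ℝ)) (x := (Finset.univ : Finset V))
  rw [Finset.powerset_univ] at h
  rw [h]
  have hb := congrArg (Polynomial.eval p) (bernsteinPolynomial.sum_smul ℝ (Fintype.card V))
  simp only [Polynomial.eval_finsetSum, nsmul_eq_mul, Polynomial.eval_mul,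
    Polynomial.eval_natCast, Polynomial.eval_X, bernsteinPolynomial, Polynomial.eval_pow,
    Polynomial.eval_sub, Polynomial.eval_one] at hb
  rw [mul_comm p, ← hb, Finset.card_univ]
  apply Finset.sum_congr rfl
  intro k _
  rw [nsmul_eq_mul]; ring

lemma two_stage {V : Type*} [Fintype V] (p q : ℝ) (g : Finset V → ℝ) :
    ∑ U : Finset V, p ^ U.card * (1 - p) ^ (Fintype.card V - U.card) *
      ∑ W ∈ U.powerset, q ^ W.card * (1 - q) ^ (U.card - W.card) * g W =
    ∑ W : Finset V, (p * q) ^ W.card * (1 - p * q) ^ (Fintype.card V - W.card) * g W := by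
  classical
  simp_rw [Finset.mul_sum]
  rw [Finset.sum_comm' (t' := Finset.univ) (s' := fun W => Finset.univ.filter (fun U => W ⊆ U))
    (by intro U W; simp)]
  apply Finset.sum_congr rfl
  intro W _
  have h := Finset.sum_pow_mul_eq_add_pow (p * (1 - q)) (1 - p) Wᶜ
  rw [show p * (1 - q) + (1 - p) = 1 - p * q by ring, Finset.card_compl] at h
  rw [← h, Finset.mul_sum, Finset.sum_mul]
  symm
  refine Finset.sum_bij' (fun S _ => S ∪ W) (fun U _ => U \ W) ?_ ?_ ?_ ?_ ?_
  · intro S _; simp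
  · intro U _; rw [Finset.mem_powerset]; intro x; simp
  · intro S hS
    rw [Finset.mem_powerset] at hS
    ext x
    have : x ∈ S → x ∉ W := fun hx => by simpa using hS hx
    simp; tauto
  · intro U hU
    exact Finset.sdiff_union_of_subset (Finset.mem_filter.1 hU).2
  · intro S hS
    rw [Finset.mem_powerset] at hS
    have hd : Disjoint S W := by
      rw [Finset.disjoint_left]; intro x hx; simpa using hS hx
    rw [Finset.card_union_of_disjoint hd]
    rw [show Fintype.card V - (S.card + W.card) = Fintype.card V - W.card - S.card by omega,
      Nat.add_sub_cancel, mul_pow, mul_pow, pow_add]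
    ring

/-- If `G` has `n` vertices and independence number `(1/4 + ε)n` with `0 < ε < 1/4`,
then the average independence number of the induced subgraph of `G` on a uniformly
random subset of the vertices is at most `(1/4 + ε - ε²/3)n`. -/
theorem average_indepNum_of_random_subset (V : Type*) [Fintype V] (G : SimpleGraph V)
    (n : ℕ) (hn : Fintype.card V = n) (ε : ℝ) (hε0 : 0 < ε) (hε : ε < 1 / 4)
    (hα : (indepNum G : ℝ) = (1 / 4 + ε) * n) :
    (∑ W : Finset V, (indepNum (G.induce (W : Set V)) : ℝ)) / 2 ^ n ≤
      (1 / 4 + ε - ε ^ 2 / 3) * n := by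
  classical
  set f : Finset V → ℕ := fun W : Finset V => indepNum (G.induce (W : Set V)) with hfdef
  have hf : IsAlphaFun G f := isAlphaFun_induce G
  have hfle : ∀ W, (f W : ℝ) ≤ (1 / 4 + ε) * n := by
    intro W
    rw [← hα]
    obtain ⟨s, -, hi, hc⟩ := hf.1 W
    exact_mod_cast hc ▸ (indepNum_spec G).2 s hi
  set q : ℝ := 1 / (1 + 4 * ε) with hq
  set p : ℝ := (1 + 4 * ε) / 2 with hp
  have hpos : 0 < 1 + 4 * ε := by linarith
  have hpq : p * q = 1 / 2 := by rw [hp, hq]; field_simp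
  have hq0 : 0 ≤ q := by rw [hq]; positivity
  have hq1 : q ≤ 1 := by rw [hq, div_le_one hpos]; linarith
  have hp0 : 0 ≤ p := by rw [hp]; positivity
  have hp1 : 0 ≤ 1 - p := by rw [hp]; linarith
  have hst := two_stage p q (tauF f)
  rw [hpq, hn] at hst
  have hhalf : ∑ W : Finset V, (1 / 2 : ℝ) ^ W.card * (1 - 1 / 2) ^ (n - W.card) * tauF f W =
      (n : ℝ) / 2 - (∑ W : Finset V, (f W : ℝ)) / 2 ^ n := by
    have hm := mean_card (V := V) (1 / 2)
    rw [hn] at hm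
    have : ∀ W : Finset V, (1 / 2 : ℝ) ^ W.card * (1 - 1 / 2) ^ (n - W.card) = 1 / 2 ^ n := by
      intro W
      have hW : W.card ≤ n := hn ▸ Finset.card_le_univ W
      rw [show (1 - 1 / 2 : ℝ) = 1 / 2 by norm_num, ← pow_add, Nat.add_sub_cancel' hW, one_div_pow]
    simp_rw [this] at hm ⊢
    simp_rw [tauF, mul_sub, Finset.sum_sub_distrib]
    rw [hm, ← Finset.mul_sum]
    ring
  rw [hhalf] at hst
  have hlow : q ^ 2 * (p * n - (1 / 4 + ε) * n) ≤
      ∑ U : Finset V, p ^ U.card * (1 - p) ^ (n - U.card) *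
      ∑ W ∈ U.powerset, q ^ W.card * (1 - q) ^ (U.card - W.card) * tauF f W := by
    have hm := mean_card (V := V) p
    have h1 := Fintype.sum_pow_mul_eq_add_pow V p (1 - p)
    rw [hn] at hm h1
    rw [add_sub_cancel, one_pow] at h1
    have e : q ^ 2 * (p * n - (1 / 4 + ε) * n) = ∑ U : Finset V,
        p ^ U.card * (1 - p) ^ (n - U.card) * (q ^ 2 * ((U.card : ℝ) - (1 / 4 + ε) * n)) := by
      calc q ^ 2 * (p * n - (1 / 4 + ε) * n)
          = q ^ 2 * (p * n) - (q ^ 2 * ((1 / 4 + ε) * n)) * 1 := by ring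
        _ = q ^ 2 * (∑ U : Finset V, p ^ U.card * (1 - p) ^ (n - U.card) * (U.card : ℝ)) -
            (q ^ 2 * ((1 / 4 + ε) * n)) *
              ∑ U : Finset V, p ^ U.card * (1 - p) ^ (n - U.card) := by rw [hm, h1]
        _ = _ := by
          rw [Finset.mul_sum, Finset.mul_sum, ← Finset.sum_sub_distrib]
          apply Finset.sum_congr rfl
          intro U _
          ring
    rw [e]
    apply Finset.sum_le_sum
    intro U _
    apply mul_le_mul_of_nonneg_left _ (by positivity)
    refine le_trans ?_ (hf.sample U q hq0 hq1)
    apply mul_le_mul_of_nonneg_left _ (by positivity)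
    have := hfle U
    unfold tauF
    linarith
  rw [hst] at hlow
  have hcalc : q ^ 2 * (p * n - (1 / 4 + ε) * n) = q / 4 * n := by
    rw [hp, hq]; field_simp; ring
  rw [hcalc] at hlow
  have hqb : 1 / 4 - ε + ε ^ 2 / 3 ≤ q / 4 := by
    rw [hq, div_div, le_div_iff₀ (by positivity)]
    nlinarith [sq_nonneg ε, mul_pos hε0 hε0, mul_nonneg (sq_nonneg ε) (sub_nonneg.2 hε.le)]
  have hn0 : (0 : ℝ) ≤ n := Nat.cast_nonneg n
  have := mul_le_mul_of_nonneg_right hqb hn0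
  change (∑ W : Finset V, (f W : ℝ)) / 2 ^ n ≤ _
  linarith
end
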